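/- Every boundary circle C of a σ-compact, non-compact, connected 2-manifold M is a retract of M; that is, there exists a continuous map r : M → C with r|_C = id_C. -/

import Mathlib

noncomputable section

open scoped Pointwise

/-- The circle `S¹`. -/
abbrev Circle2 : Type := ↥(Metric.sphere (0 : EuclideanSpace ℝ (Fin 2)) 1)

/-- The boundary `∂M` of a 2-manifold `M` modelled on the half-plane. -/
abbrev surfaceBoundary (M : Type*) [TopologicalSpace M]
    [ChartedSpace (EuclideanHalfSpace 2) M] : Set M :=
  ModelWithCorners.boundary (I := modelWithCornersEuclideanHalfSpace 2) M

section BoundaryRetract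

open Set Filter Topology Metric
open scoped unitInterval

theorem exists_log_of_homotopy {X : Type*} [TopologicalSpace X] {H : I × X → ℂ}
    (hH : Continuous H) (h0 : ∀ y, H y ≠ 0) {g : X → ℂ} (hg : Continuous g)
    (h : ∀ x, Complex.exp (g x) = H (0, x)) :
    ∃ g' : X → ℂ, Continuous g' ∧ ∀ x, Complex.exp (g' x) = H (1, x) := by
  let K : C(I × X, {z : ℂ // z ≠ 0}) := ⟨fun y => ⟨H y, h0 y⟩, by fun_prop⟩
  have cov := Complex.isCoveringMap_exp
  let L := cov.liftHomotopy K ⟨g, hg⟩ (fun x => Subtype.ext (h x).symm)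
  refine ⟨fun x => L (1, x), by fun_prop, fun x => ?_⟩
  exact congrArg Subtype.val (congrFun (cov.liftHomotopy_lifts K ⟨g, hg⟩ _) (1, x))

theorem StarConvex.exists_log {E : Type*} [AddCommGroup E] [Module ℝ E] [TopologicalSpace E]
    [IsTopologicalAddGroup E] [ContinuousSMul ℝ E] {S : Set E} {s : E} (hS : StarConvex ℝ s S)
    (hs : s ∈ S) {f : E → ℂ} (hf : ContinuousOn f S) (h0 : ∀ x ∈ S, f x ≠ 0) :
    ∃ g : E → ℂ, ContinuousOn g S ∧ ∀ x ∈ S, Complex.exp (g x) = f x := by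
  have mem : ∀ y : I × S, s + (y.1 : ℝ) • ((y.2 : E) - s) ∈ S := fun y =>
    hS.add_smul_sub_mem y.2.2 y.1.2.1 y.1.2.2
  obtain ⟨g, hg, hgf⟩ := exists_log_of_homotopy (X := S)
    (H := fun y => f (s + (y.1 : ℝ) • ((y.2 : E) - s)))
    (hf.comp_continuous (by fun_prop) mem) (fun y => h0 _ (mem y))
    (g := fun _ => Complex.log (f s)) continuous_const
    (fun x => by simp [Complex.exp_log (h0 s hs)])
  classical
  refine ⟨fun x => if h : x ∈ S then g ⟨x, h⟩ else 0, ?_, fun x hx => ?_⟩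
  · rw [continuousOn_iff_continuous_domRestrict]
    exact hg.congr fun x => by rw [Set.domRestrict_apply, dif_pos x.2]
  · simp [hx, hgf]

theorem IsPreconnected.exp_eq_exp {X : Type*} [TopologicalSpace X] {S : Set X}
    (hS : IsPreconnected S) {f g : X → ℂ} (hf : ContinuousOn f S) (hg : ContinuousOn g S)
    (h : ∀ x ∈ S, Complex.exp (f x) = Complex.exp (g x)) :
    ∃ n : ℤ, ∀ x ∈ S, f x = g x + n * (2 * Real.pi * Complex.I) := by
  rcases S.eq_empty_or_nonempty with rfl | ⟨a, ha⟩
  · exact ⟨0, by simp⟩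
  have h1 : ∀ x ∈ S, ∃ n : ℤ, f x = g x + n * (2 * Real.pi * Complex.I) := fun x hx =>
    Complex.exp_eq_exp_iff_exists_int.1 (h x hx)
  have h2 : ∀ x (n : ℤ), f x = g x + n * (2 * Real.pi * Complex.I) →
      ((f x - g x) / (2 * Real.pi * Complex.I)).re = n := by
    intro x n hn
    have : (2 * Real.pi * Complex.I) ≠ 0 := Complex.two_pi_I_ne_zero
    rw [hn, add_sub_cancel_left, mul_div_cancel_right₀ _ this]
    simp
  have hd : IsDiscrete (Set.range ((↑) : ℤ → ℝ)) := by
    exact ⟨Int.isClosedEmbedding_coe_real.isEmbedding.toHomeomorph.symm.isEmbedding.discreteTopology⟩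
  obtain ⟨n, hn⟩ := h1 a ha
  refine ⟨n, fun x hx => ?_⟩
  obtain ⟨m, hm⟩ := h1 x hx
  have hc : ContinuousOn (fun x => ((f x - g x) / (2 * Real.pi * Complex.I)).re) S := by
    fun_prop
  have := hS.constant_of_mapsTo hd hc
    (fun y hy => by obtain ⟨k, hk⟩ := h1 y hy; exact ⟨k, (h2 y k hk).symm⟩) hx ha
  simp only [h2 x m hm, h2 a n hn, Int.cast_inj] at this
  rw [hm, this]

theorem convex_re_lt (c : ℝ) : Convex ℝ {w : ℂ | w.re < c} :=
  convex_halfSpace_lt Complex.reLm.isLinear c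

theorem add_exp_mem_ball {p w : ℂ} {ε : ℝ} (hε : 0 < ε) (hw : w.re < Real.log ε) :
    p + Complex.exp w ∈ ball p ε \ {p} := by
  refine ⟨?_, by simp⟩
  rw [mem_ball, dist_eq_norm, add_sub_cancel_left, Complex.norm_exp]
  calc _ < Real.exp (Real.log ε) := Real.exp_lt_exp.2 hw
    _ = ε := Real.exp_log hε

theorem log_sub_re_lt {p z : ℂ} {ε : ℝ} (hz : z ∈ ball p ε \ {p}) :
    (Complex.log (z - p)).re < Real.log ε := by
  rw [Complex.log_re]
  have h : z - p ≠ 0 := sub_ne_zero.2 hz.2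
  exact Real.log_lt_log (norm_pos_iff.2 h) (by simpa [dist_eq_norm] using hz.1)

theorem not_exists_log_sub {p : ℂ} {ε : ℝ} (hε : 0 < ε) {g : ℂ → ℂ}
    (hg : ContinuousOn g (ball p ε \ {p}))
    (h : ∀ z ∈ ball p ε \ {p}, Complex.exp (g z) = z - p) : False := by
  obtain ⟨n, hn⟩ := (convex_re_lt (Real.log ε)).isPreconnected.exp_eq_exp
    (f := fun w => g (p + Complex.exp w)) (g := id)
    (hg.comp (by fun_prop) fun w hw => add_exp_mem_ball hε hw) continuousOn_id
    (fun w hw => by rw [h _ (add_exp_mem_ball hε hw)]; simp)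
  have h1 := hn (Real.log ε - 1 : ℝ) (by simp)
  have h2 := hn ((Real.log ε - 1 : ℝ) + 2 * Real.pi * Complex.I) (by simp)
  simp only [Complex.exp_add, Complex.exp_two_pi_mul_I, mul_one] at h2
  rw [h1] at h2
  simp [Complex.I_ne_zero, Real.pi_ne_zero] at h2

theorem exists_zpow_mul_exp_of_ball {p : ℂ} {ε : ℝ} (hε : 0 < ε) {f : ℂ → ℂ}
    (hf : ContinuousOn f (ball p ε \ {p})) (h0 : ∀ z ∈ ball p ε \ {p}, f z ≠ 0) :
    ∃ (n : ℤ) (g : ℂ → ℂ), ContinuousOn g (ball p ε \ {p}) ∧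
      ∀ z ∈ ball p ε \ {p}, f z = (z - p) ^ n * Complex.exp (g z) := by
  set S := {w : ℂ | w.re < Real.log ε} with hSdef
  have hS : Convex ℝ S := convex_re_lt _
  have hb : ((Real.log ε - 1 : ℝ) : ℂ) ∈ S := by simp [S]
  obtain ⟨G, hG, hGf⟩ := (hS.starConvex hb).exists_log hb (f := fun w => f (p + Complex.exp w))
    (hf.comp (by fun_prop) fun w hw => add_exp_mem_ball hε hw)
    (fun w hw => h0 _ (add_exp_mem_ball hε hw))
  have hT : ∀ w ∈ S, w + 2 * Real.pi * Complex.I ∈ S := fun w hw => by simpa [S] using hw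
  obtain ⟨n, hn⟩ := hS.isPreconnected.exp_eq_exp
    (f := fun w => G (w + 2 * Real.pi * Complex.I)) (g := G)
    (hG.comp (by fun_prop) hT) hG
    (fun w hw => by rw [hGf w hw, hGf _ (hT w hw)]; simp [Complex.exp_add])
  set K : ℂ → ℂ := fun w => G w - n * w with hK
  have hKc : ContinuousOn K S := by fun_prop
  have hKp : ∀ w ∈ S, K (w + 2 * Real.pi * Complex.I) = K w := fun w hw => by
    simp only [hK, hn w hw]; ring
  have hKm : ∀ (m : ℕ), ∀ w ∈ S, K (w + m * (2 * Real.pi * Complex.I)) = K w := by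
    intro m
    induction m with
    | zero => simp
    | succ m ih =>
      intro w hw
      rw [← ih w hw, ← hKp (w + m * _) (by simpa [S] using hw)]
      congr 1; push_cast; ring
  have hKe : ∀ w ∈ S, ∀ w' ∈ S, Complex.exp w = Complex.exp w' → K w = K w' := by
    intro w hw w' hw' h
    obtain ⟨m, hm⟩ := Complex.exp_eq_exp_iff_exists_int.1 h
    obtain ⟨k, rfl | rfl⟩ := m.eq_nat_or_neg
    · rw [hm]; exact_mod_cast hKm k w' hw'
    · rw [← hKm k w hw, hm]; congr 1; push_cast; ring
  refine ⟨n, fun z => K (Complex.log (z - p)), ?_, fun z hz => ?_⟩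
  · intro z₀ hz₀
    have hz₀' : z₀ - p ≠ 0 := sub_ne_zero.2 hz₀.2
    set u : ℂ → ℂ := fun z => Complex.log ((z - p) / (z₀ - p)) + Complex.log (z₀ - p) with hu
    have hu0 : u z₀ = Complex.log (z₀ - p) := by simp [hu, div_self hz₀']
    have huc : ContinuousAt u z₀ := by
      refine ContinuousAt.add (ContinuousAt.clog (by fun_prop) ?_) continuousAt_const
      simp [div_self hz₀']
    have hmem : u z₀ ∈ S := by rw [hu0]; exact log_sub_re_lt hz₀
    have hSo : IsOpen S := isOpen_lt Complex.continuous_re continuous_const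
    have h1 : ∀ᶠ z in 𝓝 z₀, u z ∈ S := huc.eventually (hSo.mem_nhds hmem)
    have h2 : ContinuousAt (fun z => K (u z)) z₀ :=
      ContinuousAt.comp (g := K) (hKc.continuousAt (hSo.mem_nhds hmem)) huc
    refine (h2.continuousWithinAt (s := ball p ε \ {p})).congr_of_eventuallyEq ?_ ?_
    · filter_upwards [mem_nhdsWithin_of_mem_nhds h1, self_mem_nhdsWithin] with z hz1 hz
      have hz' : z - p ≠ 0 := sub_ne_zero.2 hz.2
      refine hKe _ (log_sub_re_lt hz) _ hz1 ?_
      rw [Complex.exp_log hz', hu]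
      simp only [Complex.exp_add]
      rw [Complex.exp_log hz₀', Complex.exp_log (div_ne_zero hz' hz₀'), div_mul_cancel₀ _ hz₀']
    · simp only [hu0]
  · have hz' : z - p ≠ 0 := sub_ne_zero.2 hz.2
    simp only [hK, Complex.exp_sub, hGf _ (log_sub_re_lt hz), Complex.exp_log hz',
      add_sub_cancel, Complex.exp_int_mul]
    field_simp [zpow_ne_zero n hz']

theorem StarConvex.exists_zpow_mul_exp {p : ℂ} {T : Set ℂ} (hT : StarConvex ℝ p T) (hp : T ∈ 𝓝 p)
    {f : ℂ → ℂ} (hf : ContinuousOn f (T \ {p})) (h0 : ∀ z ∈ T \ {p}, f z ≠ 0) :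
    ∃ (n : ℤ) (g : ℂ → ℂ), ContinuousOn g (T \ {p}) ∧
      ∀ z ∈ T \ {p}, f z = (z - p) ^ n * Complex.exp (g z) := by
  obtain ⟨ε, hε, hεT⟩ := Metric.mem_nhds_iff.1 hp
  obtain ⟨n, g, hg, hgf⟩ := exists_zpow_mul_exp_of_ball hε
    (hf.mono (sdiff_subset_sdiff_left hεT)) fun z hz => h0 z ⟨hεT hz.1, hz.2⟩
  set s : I × (T \ {p} : Set ℂ) → ℝ := fun y => y.1 + (1 - y.1) * (ε / (ε + ‖(y.2 : ℂ) - p‖)) with hs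
  have hden : ∀ y : I × (T \ {p} : Set ℂ), 0 < ε + ‖(y.2 : ℂ) - p‖ := fun y => by positivity
  have hne : ∀ y : I × (T \ {p} : Set ℂ), (y.2 : ℂ) - p ≠ 0 := fun y => sub_ne_zero.2 y.2.2.2
  have hsc : Continuous s := by
    have := fun y => (hden y).ne'
    fun_prop (disch := assumption)
  have hs0 : ∀ y, 0 < s y := fun y => by
    have h1 : 0 < ε / (ε + ‖(y.2 : ℂ) - p‖) := div_pos hε (hden y)
    have h2 := y.1.2.1
    have h3 := y.1.2.2
    rcases h2.eq_or_lt with h | h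
    · simp only [hs, ← h]; linarith
    · have : 0 ≤ (1 - (y.1 : ℝ)) * (ε / (ε + ‖(y.2 : ℂ) - p‖)) :=
        mul_nonneg (by linarith) h1.le
      simp only [hs]; linarith
  have hs1 : ∀ y, s y ≤ 1 := fun y => by
    have h1 : ε / (ε + ‖(y.2 : ℂ) - p‖) ≤ 1 :=
      (div_le_one (hden y)).2 (le_add_of_nonneg_right (norm_nonneg _))
    have h3 := y.1.2.2
    have := mul_le_mul_of_nonneg_left h1 (sub_nonneg.2 h3)
    simp only [hs]; linarith
  set r : I × (T \ {p} : Set ℂ) → ℂ := fun y => p + s y • ((y.2 : ℂ) - p) with hr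
  have hrc : Continuous r := by fun_prop
  have hrp : ∀ y, r y - p ≠ 0 := fun y => by
    simp only [hr, add_sub_cancel_left]
    exact smul_ne_zero (hs0 y).ne' (hne y)
  have hrT : ∀ y, r y ∈ T \ {p} := fun y =>
    ⟨hT.add_smul_sub_mem y.2.2.1 (hs0 y).le (hs1 y), fun h => hrp y (sub_eq_zero.2 h)⟩
  have hrb : ∀ x : (T \ {p} : Set ℂ), r (0, x) ∈ ball p ε \ {p} := fun x => by
    refine ⟨?_, (hrT _).2⟩
    have h1 := hden (0, x)
    simp only [hr, hs, mem_ball, dist_eq_norm, add_sub_cancel_left, norm_smul, Real.norm_eq_abs]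
    simp only [Set.Icc.coe_zero, sub_zero, one_mul, zero_add]
    rw [abs_of_pos (div_pos hε h1), div_mul_eq_mul_div, div_lt_iff₀ h1]
    nlinarith [norm_nonneg ((x : ℂ) - p)]
  obtain ⟨G, hG, hGf⟩ := exists_log_of_homotopy (X := (T \ {p} : Set ℂ))
    (H := fun y => f (r y) / (r y - p) ^ n)
    ((hf.comp_continuous hrc hrT).div ((hrc.sub continuous_const).zpow₀ n fun y => Or.inl (hrp y))
      fun y => zpow_ne_zero n (hrp y))
    (fun y => div_ne_zero (h0 _ (hrT y)) (zpow_ne_zero n (hrp y)))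
    (g := fun x => g (r (0, x)))
    (hg.comp_continuous (by fun_prop) hrb)
    (fun x => by
      rw [hgf _ (hrb x), mul_div_cancel_left₀ _ (zpow_ne_zero n (hrp _))])
  classical
  refine ⟨n, fun x => if h : x ∈ T \ {p} then G ⟨x, h⟩ else 0, ?_, fun z hz => ?_⟩
  · rw [continuousOn_iff_continuous_domRestrict]
    exact hG.congr fun x => by rw [Set.domRestrict_apply, dif_pos x.2]
  · have h1 := hGf ⟨z, hz⟩
    have h2 : r (1, ⟨z, hz⟩) = z := by simp [hr, hs]
    have h3 : z - p ≠ 0 := sub_ne_zero.2 hz.2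
    simp only [h2] at h1
    simp only [hz, dite_true, h1]
    rw [mul_div_cancel₀ _ (zpow_ne_zero n h3)]

theorem isCompact_segment (a b : ℂ) : IsCompact (segment ℝ a b) := by
  rw [segment_eq_image]
  exact isCompact_Icc.image (by fun_prop)

theorem div_mem_slitPlane_of_notMem_segment {p q z : ℂ} (h : z ∉ segment ℝ p q) :
    (z - p) / (z - q) ∈ Complex.slitPlane := by
  have hq : z - q ≠ 0 := sub_ne_zero.2 fun h' => h (h' ▸ right_mem_segment ℝ p q)
  by_contra hw
  rw [Complex.mem_slitPlane_iff_not_le_zero, not_not, Complex.nonpos_iff] at hw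
  set w := (z - p) / (z - q) with hwdef
  have hwr : w = -((-w.re : ℝ) : ℂ) := by
    apply Complex.ext <;> simp [hw.2]
  set r := -w.re with hr
  have hr0 : 0 ≤ r := by simp only [hr]; linarith [hw.1]
  have h1 : z - p = w * (z - q) := by rw [hwdef, div_mul_cancel₀ _ hq]
  rw [hwr] at h1
  refine h ⟨1 / (1 + r), r / (1 + r), by positivity, by positivity, ?_, ?_⟩
  · field_simp
  · have h2 : (1 + (r : ℂ)) ≠ 0 := by
      have : (1 + r) ≠ 0 := by positivity
      exact_mod_cast this
    simp only [Complex.real_smul]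
    push_cast
    field_simp
    linear_combination -h1

theorem continuousOn_cutoff_mul {M : Type*} [TopologicalSpace M] {D K : Set M} (hD : IsOpen D)
    (hK : IsClosed K) {χ F : M → ℂ} (hχ : Continuous χ) (hχD : tsupport χ ⊆ D)
    (hF : ContinuousOn F (D \ K)) : ContinuousOn (fun x => χ x * F x) Kᶜ := by
  intro x hx
  apply ContinuousAt.continuousWithinAt
  by_cases hxD : x ∈ D
  · exact hχ.continuousAt.mul (hF.continuousAt ((hD.sdiff hK).mem_nhds ⟨hxD, hx⟩))
  · have h1 : ∀ᶠ y in 𝓝 x, χ y = 0 := by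
      filter_upwards [(isClosed_tsupport χ).isOpen_compl.mem_nhds fun h => hxD (hχD h)] with y hy
      exact image_eq_zero_of_notMem_tsupport hy
    refine (continuousAt_const (y := (0 : ℂ))).congr ?_
    filter_upwards [h1] with y hy
    simp [hy]

theorem exists_cutoff {M : Type*} [TopologicalSpace M] [T2Space M] [NormalSpace M]
    {D K : Set M} (hD : IsOpen D) (hK : IsClosed K) (hKD : K ⊆ D) :
    ∃ χ : M → ℂ, Continuous χ ∧ tsupport χ ⊆ D ∧ ∃ V, IsOpen V ∧ K ⊆ V ∧ ∀ x ∈ V, χ x = 1 := by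
  obtain ⟨V, hVo, hKV, hVD⟩ := normal_exists_closure_subset hK hD hKD
  obtain ⟨W, hWo, hVW, hWD⟩ := normal_exists_closure_subset isClosed_closure hD hVD
  obtain ⟨χ, h0, h1, -⟩ := exists_continuous_zero_one_of_isClosed hWo.isClosed_compl
    (isClosed_closure (s := V)) (by
      rw [Set.disjoint_left]; exact fun x hx hx' => hx (hVW hx'))
  refine ⟨fun x => (χ x : ℂ), by fun_prop, ?_, V, hVo, hKV, fun x hx => ?_⟩
  · refine (closure_mono fun x hx => ?_).trans hWD
    by_contra hxW
    exact hx (by simp [h0 hxW])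
  · simp [h1 (subset_closure hx)]

/-- Replace `f` by `u` near the closed set `K`, using a logarithm `F` of `u / f` on `D \ K`. -/
theorem exists_glue {M : Type*} [TopologicalSpace M] [T2Space M] [NormalSpace M]
    {D K : Set M} (hD : IsOpen D) (hK : IsClosed K) (hKD : K ⊆ D) {q : M} (hq : q ∈ K)
    {f u F : M → ℂ} (hf : ContinuousOn f Kᶜ) (hf0 : ∀ x ∉ K, f x ≠ 0)
    (hu : ContinuousOn u (D \ {q})) (hu0 : ∀ x ∈ D \ {q}, u x ≠ 0)
    (hF : ContinuousOn F (D \ K)) (h : ∀ x ∈ D \ K, f x * Complex.exp (F x) = u x) :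
    ∃ f' l : M → ℂ, ContinuousOn f' {q}ᶜ ∧ (∀ x, f' x ≠ 0) ∧ (∀ x ∉ D, f' x = f x) ∧
      ContinuousOn l Kᶜ ∧ (∀ x ∉ K, f' x = f x * Complex.exp (l x)) ∧
      (∀ x ∈ K, x ≠ q → f' x = u x) ∧ ∃ V, IsOpen V ∧ K ⊆ V ∧ ∀ x ∈ V \ K, l x = F x := by
  classical
  obtain ⟨χ, hχ, hχD, V, hV, hKV, hV1⟩ := exists_cutoff hD hK hKD
  have hVD : V ⊆ D := fun x hx => hχD <| subset_tsupport _ <| by simp [hV1 x hx]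
  have hl := continuousOn_cutoff_mul hD hK hχ hχD hF
  set f' : M → ℂ := fun x => if x = q then 1 else if x ∈ K then u x else
    f x * Complex.exp (χ x * F x) with hf'
  have hfK : ∀ x ∉ K, f' x = f x * Complex.exp (χ x * F x) := fun x hx => by
    have : x ≠ q := fun h => hx (h ▸ hq)
    simp [hf', hx, this]
  have hfV : ∀ x ∈ V \ {q}, f' x = u x := fun x hx => by
    have hxq : x ≠ q := hx.2
    by_cases hxK : x ∈ K
    · simp [hf', hxq, hxK]
    · rw [hfK x hxK, hV1 x hx.1, one_mul, h x ⟨hVD hx.1, hxK⟩]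
  refine ⟨f', fun x => χ x * F x, fun x hx => ?_, fun x => ?_, fun x hx => ?_, hl, hfK,
    fun x hx hxq => hfV x ⟨hKV hx, hxq⟩, V, hV, hKV, fun x hx => by simp [hV1 x hx.1]⟩
  · apply ContinuousAt.continuousWithinAt
    by_cases hxK : x ∈ K
    · refine ((hu.continuousAt ((hD.sdiff isClosed_singleton).mem_nhds ⟨hKD hxK, hx⟩)).congr ?_)
      filter_upwards [(hV.sdiff isClosed_singleton).mem_nhds ⟨hKV hxK, hx⟩] with y hy
      exact (hfV y hy).symm
    · have hn := hK.isOpen_compl.mem_nhds hxK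
      refine ((hf.continuousAt hn).mul (hl.continuousAt hn).cexp).congr ?_
      filter_upwards [hn] with y hy
      exact (hfK y hy).symm
  · by_cases hxq : x = q
    · simp [hf', hxq]
    by_cases hxK : x ∈ K
    · rw [hfV x ⟨hKV hxK, hxq⟩]; exact hu0 x ⟨hKD hxK, hxq⟩
    · rw [hfK x hxK]; exact mul_ne_zero (hf0 x hxK) (Complex.exp_ne_zero _)
  · rw [hfK x fun h => hx (hKD h), image_eq_zero_of_notMem_tsupport fun h => hx (hχD h)]
    simp

/-- A chart of `M` onto a convex relatively open subset of the closed upper half-plane. -/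
structure HalfPlaneChart (M : Type*) [TopologicalSpace M] extends PartialEquiv M ℂ where
  isOpen_source : IsOpen source
  continuousOn : ContinuousOn toFun source
  continuousOn_symm : ContinuousOn invFun target
  exists_isOpen : ∃ U, IsOpen U ∧ target = U ∩ {z | 0 ≤ z.im}
  convex : Convex ℝ target

namespace HalfPlaneChart

variable {M : Type*} [TopologicalSpace M] (e : HalfPlaneChart M)

theorem im_nonneg {x : M} (hx : x ∈ e.source) : 0 ≤ (e.toPartialEquiv x).im := by
  obtain ⟨U, -, hU⟩ := e.exists_isOpen
  have := e.map_source hx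
  rw [hU] at this
  exact this.2

theorem mem_nhdsWithin {x : M} (hx : x ∈ e.source) :
    e.target ∈ 𝓝[{z | 0 ≤ z.im}] (e.toPartialEquiv x) := by
  obtain ⟨U, hUo, hU⟩ := e.exists_isOpen
  have := e.map_source hx
  rw [hU] at this ⊢
  exact inter_mem (mem_nhdsWithin_of_mem_nhds (hUo.mem_nhds this.1)) self_mem_nhdsWithin

theorem target_mem_nhds {x : M} (hx : x ∈ e.source) (hi : 0 < (e.toPartialEquiv x).im) :
    e.target ∈ 𝓝 (e.toPartialEquiv x) := by
  have h := e.mem_nhdsWithin hx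
  rwa [nhdsWithin_eq_nhds.2] at h
  filter_upwards [(isOpen_lt continuous_const Complex.continuous_im).mem_nhds hi] with z hz
  exact le_of_lt hz

theorem preimage_mem_nhdsWithin {x : M} (hx : x ∈ e.source) {V : Set M} (hV : V ∈ 𝓝 x) :
    e.target ∩ e.symm ⁻¹' V ∈ 𝓝[{z | 0 ≤ z.im}] (e.toPartialEquiv x) := by
  have h1 := e.continuousOn_symm _ (e.map_source hx)
  have h2 : e.symm ⁻¹' V ∈ 𝓝[e.target] (e.toPartialEquiv x) := by
    apply h1.preimage_mem_nhdsWithin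
    change V ∈ 𝓝 (e.symm (e.toPartialEquiv x))
    rwa [e.left_inv hx]
  have h3 := e.mem_nhdsWithin hx
  refine inter_mem h3 ?_
  rw [mem_nhdsWithin_iff_exists_mem_nhds_inter] at h2 h3 ⊢
  obtain ⟨u, hu, hu'⟩ := h2
  obtain ⟨v, hv, hv'⟩ := h3
  exact ⟨u ∩ v, inter_mem hu hv, fun z hz => hu' ⟨hz.1.1, hv' ⟨hz.1.2, hz.2⟩⟩⟩

/-- A point of the interior of one chart lies in the interior of every chart around it. -/
theorem im_pos_of_im_pos (e' : HalfPlaneChart M) {x : M} (hx : x ∈ e.source) (hx' : x ∈ e'.source)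
    (hi : 0 < (e.toPartialEquiv x).im) : 0 < (e'.toPartialEquiv x).im := by
  by_contra hi'
  replace hi' : (e'.toPartialEquiv x).im = 0 := le_antisymm (not_lt.1 hi') (e'.im_nonneg hx')
  set a := e.toPartialEquiv x with ha
  set c := e'.toPartialEquiv x with hc
  obtain ⟨r, hr, hrb⟩ := Metric.mem_nhdsWithin_iff.1
    (e'.preimage_mem_nhdsWithin hx' (e.isOpen_source.mem_nhds hx))
  set S : Set ℂ := (ball c r ∩ {z | 0 ≤ z.im}) \ {c} with hS
  have hSmem : ∀ z ∈ S, z ∈ e'.target ∧ e'.symm z ∈ e.source := fun z hz => hrb hz.1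
  set s : ℂ := c + (r / 2 : ℝ) * Complex.I with hs
  have hsS : s ∈ S := by
    refine ⟨⟨?_, ?_⟩, ?_⟩
    · simp [hs, dist_eq_norm, abs_of_pos hr, hr]
    · simp only [hs, mem_ofPred_eq]; simp [hi']; positivity
    · simp [hs, hr.ne', Complex.ext_iff]
  have hstar : StarConvex ℝ s S := by
    intro z hz α β hα hβ hαβ
    have hconv : Convex ℝ (ball c r ∩ {z : ℂ | 0 ≤ z.im}) :=
      (convex_ball c r).inter (convex_halfSpace_ge Complex.imLm.isLinear 0)
    refine ⟨hconv hsS.1 hz.1 hα hβ hαβ, fun h => ?_⟩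
    have him := congrArg Complex.im h
    simp only [Complex.add_im, Complex.smul_im, hs, hi', smul_eq_mul, Complex.mul_im,
      Complex.ofReal_re, Complex.ofReal_im, Complex.I_im, Complex.I_re] at him
    have hz0 : 0 ≤ z.im := hz.1.2
    rcases hα.eq_or_lt with h0 | h0
    · have hβ1 : β = 1 := by linarith
      rw [← h0, hβ1] at h
      exact hz.2 (by simpa using h)
    · have h1 : 0 ≤ β * z.im := mul_nonneg hβ hz0
      have h2 : 0 < α * r := mul_pos h0 hr
      linarith
  have hcont : ContinuousOn (fun z => e.toPartialEquiv (e'.symm z) - a) S :=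
    (e.continuousOn.comp (e'.continuousOn_symm.mono fun z hz => (hSmem z hz).1)
      fun z hz => (hSmem z hz).2).sub continuousOn_const
  obtain ⟨g, hg, hgf⟩ := hstar.exists_log hsS hcont fun z hz h => hz.2 <| by
    have h1 := e.injOn (hSmem z hz).2 hx (sub_eq_zero.1 h)
    rw [mem_singleton_iff, hc, ← h1, e'.right_inv (hSmem z hz).1]
  have hV : e'.source ∩ e'.toPartialEquiv ⁻¹' ball c r ∈ 𝓝 x :=
    inter_mem (e'.isOpen_source.mem_nhds hx')
      ((e'.continuousOn.continuousAt (e'.isOpen_source.mem_nhds hx')).preimage_mem_nhds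
        (ball_mem_nhds c hr))
  have hV' := inter_mem (e.preimage_mem_nhdsWithin hx hV) (mem_nhdsWithin_of_mem_nhds
    (e.target_mem_nhds hx hi))
  rw [nhdsWithin_eq_nhds.2] at hV'
  swap
  · filter_upwards [(isOpen_lt continuous_const Complex.continuous_im).mem_nhds hi] with z hz
    exact le_of_lt hz
  obtain ⟨ε, hε, hεb⟩ := Metric.mem_nhds_iff.1 hV'
  have hmaps : ∀ z ∈ ball a ε \ {a}, e'.toPartialEquiv (e.symm z) ∈ S := fun z hz => by
    obtain ⟨⟨hz1, hz2, hz3⟩, hz4⟩ := hεb hz.1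
    refine ⟨⟨hz3, e'.im_nonneg hz2⟩, fun h => hz.2 ?_⟩
    have h1 := e'.injOn hz2 hx' h
    rw [mem_singleton_iff, ha, ← h1, e.right_inv hz1]
  refine not_exists_log_sub (p := a) hε (g := fun z => g (e'.toPartialEquiv (e.symm z))) ?_ ?_
  · refine hg.comp ?_ hmaps
    refine e'.continuousOn.comp (e.continuousOn_symm.mono fun z hz => (hεb hz.1).1.1) ?_
    exact fun z hz => (hεb hz.1).1.2.1
  · intro z hz
    simp only [hgf _ (hmaps z hz)]
    rw [e'.left_inv (hεb hz.1).1.2.1, e.right_inv (hεb hz.1).1.1]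

theorem isCompact_symm_image {K : Set ℂ} (hK : IsCompact K) (hKT : K ⊆ e.target) :
    IsCompact (e.symm '' K) :=
  hK.image_of_continuousOn (e.continuousOn_symm.mono hKT)

theorem mem_symm_image_iff {K : Set ℂ} (hKT : K ⊆ e.target) {x : M} (hx : x ∈ e.source) :
    x ∈ e.symm '' K ↔ e.toPartialEquiv x ∈ K := by
  constructor
  · rintro ⟨z, hz, rfl⟩
    rwa [e.right_inv (hKT hz)]
  · exact fun h => ⟨_, h, e.left_inv hx⟩

theorem symm_image_subset {K : Set ℂ} (hKT : K ⊆ e.target) : e.symm '' K ⊆ e.source := by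
  rintro _ ⟨z, hz, rfl⟩
  exact e.map_target (hKT hz)

/-- A pole at an interior point `p` of a chart may be moved to another interior point `q`. -/
theorem exists_move_pole [T2Space M] [NormalSpace M] {p q : M} (hp : p ∈ e.source)
    (hq : q ∈ e.source) (hpi : 0 < (e.toPartialEquiv p).im) (hqi : 0 < (e.toPartialEquiv q).im)
    {f : M → ℂ} (hf : ContinuousOn f {p}ᶜ) (h0 : ∀ x, f x ≠ 0) :
    ∃ f' : M → ℂ, ContinuousOn f' {q}ᶜ ∧ (∀ x, f' x ≠ 0) ∧ (∀ x ∉ e.source, f' x = f x) ∧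
      ∃ l : M → ℂ, ContinuousOn l (e.source ∩ {x | 0 < (e.toPartialEquiv x).im})ᶜ ∧
        ∀ x ∉ e.source ∩ {x | 0 < (e.toPartialEquiv x).im}, f' x = f x * Complex.exp (l x) := by
  set a := e.toPartialEquiv p with ha
  set b := e.toPartialEquiv q with hb
  have hsT : segment ℝ a b ⊆ e.target := e.convex.segment_subset (e.map_source hp) (e.map_source hq)
  have hsi : segment ℝ a b ⊆ {z | 0 < z.im} :=
    (convex_halfSpace_gt Complex.imLm.isLinear 0).segment_subset hpi hqi
  set K := e.symm '' segment ℝ a b with hKdef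
  have hKD : K ⊆ e.source := e.symm_image_subset hsT
  have hKmem : ∀ {x}, x ∈ e.source → (x ∈ K ↔ e.toPartialEquiv x ∈ segment ℝ a b) :=
    fun hx => e.mem_symm_image_iff hsT hx
  have hKi : K ⊆ e.source ∩ {x | 0 < (e.toPartialEquiv x).im} := fun x hx =>
    ⟨hKD hx, hsi ((hKmem (hKD hx)).1 hx)⟩
  have hKc : IsClosed K :=
    (e.isCompact_symm_image (isCompact_segment a b) hsT).isClosed
  have hpK : p ∈ K := (hKmem hp).2 (left_mem_segment ℝ a b)
  have hqK : q ∈ K := (hKmem hq).2 (right_mem_segment ℝ a b)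
  have hsymm : MapsTo e.symm (e.target \ {a}) {p}ᶜ := fun z hz h => hz.2 <| by
    rw [mem_singleton_iff, ha, ← mem_singleton_iff.1 h, e.right_inv hz.1]
  obtain ⟨n, g, hg, hgf⟩ := (e.convex.starConvex (e.map_source hp)).exists_zpow_mul_exp
    (e.target_mem_nhds hp hpi) (f := fun z => f (e.symm z))
    (hf.comp (e.continuousOn_symm.mono sdiff_subset) hsymm) (fun z _ => h0 _)
  have hmaps : MapsTo e.toPartialEquiv (e.source \ K) (e.target \ {a}) := fun x hx =>
    ⟨e.map_source hx.1, fun h => hx.2 (e.injOn hx.1 hp h ▸ hpK)⟩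
  have hζ : ContinuousOn e.toPartialEquiv (e.source \ K) := e.continuousOn.mono sdiff_subset
  have hne : ∀ x ∈ e.source \ K, e.toPartialEquiv x - a ≠ 0 := fun x hx =>
    sub_ne_zero.2 (hmaps hx).2
  have hneb : ∀ x ∈ e.source \ {q}, e.toPartialEquiv x - b ≠ 0 := fun x hx =>
    sub_ne_zero.2 fun h => hx.2 (e.injOn hx.1 hq h)
  have hslit : ∀ x ∈ e.source \ K,
      (e.toPartialEquiv x - b) / (e.toPartialEquiv x - a) ∈ Complex.slitPlane := fun x hx =>
    div_mem_slitPlane_of_notMem_segment fun h => hx.2 ((hKmem hx.1).2 (segment_symm ℝ a b ▸ h))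
  obtain ⟨f', l, h1, h2, h3, h4, h5, -, -⟩ := exists_glue (f := f) e.isOpen_source hKc hKD hqK
    (u := fun x => (e.toPartialEquiv x - b) ^ n)
    (F := fun x => n * Complex.log ((e.toPartialEquiv x - b) / (e.toPartialEquiv x - a))
      - g (e.toPartialEquiv x))
    (hf.mono fun x hx h => hx (h ▸ hpK)) (fun x _ => h0 x)
    (((e.continuousOn.mono sdiff_subset).sub continuousOn_const).zpow₀ n
      fun x hx => Or.inl (hneb x hx))
    (fun x hx => zpow_ne_zero n (hneb x hx))
    ((continuousOn_const.mul (((hζ.sub continuousOn_const).div (hζ.sub continuousOn_const)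
      hne).clog hslit)).sub (hg.comp hζ hmaps))
    (fun x hx => by
      have hx1 := hgf _ (hmaps hx)
      simp only [e.left_inv hx.1, ← ha] at hx1
      have hx2 := hne x hx
      have hx3 := Complex.slitPlane_ne_zero (hslit x hx)
      rw [hx1, Complex.exp_sub, Complex.exp_int_mul, Complex.exp_log hx3, div_zpow]
      field_simp [zpow_ne_zero n hx2])
  exact ⟨f', h1, h2, h3, l, h4.mono (compl_subset_compl.2 hKi), fun x hx => h5 x fun h => hx (hKi h)⟩

end HalfPlaneChart

theorem Complex.log_eq_log_neg_add_of_im_pos {w : ℂ} (h : 0 < w.im) :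
    Complex.log w = Complex.log (-w) + Real.pi * Complex.I := by
  simp only [Complex.log, norm_neg, Complex.arg_neg_eq_arg_sub_pi_of_im_pos h]
  push_cast
  ring

theorem Complex.log_eq_log_neg_sub_of_im_neg {w : ℂ} (h : w.im < 0) :
    Complex.log w = Complex.log (-w) - Real.pi * Complex.I := by
  simp only [Complex.log, norm_neg, Complex.arg_neg_eq_arg_add_pi_of_im_neg h]
  push_cast
  ring

theorem notMem_segment_reflection {a γ z : ℂ} (hγ : γ.im = 0) (ha : 0 < a.im) (hz : 0 ≤ z.im)
    (h : z ∉ segment ℝ γ a) : z ∉ segment ℝ a (2 * γ - a) := by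
  rintro ⟨α, β, hα, hβ, hαβ, rfl⟩
  refine h ⟨2 * β, α - β, by positivity, ?_, by linarith, ?_⟩
  · simp only [Complex.add_im, Complex.smul_im, Complex.sub_im, Complex.mul_im, hγ, smul_eq_mul,
      Complex.re_ofNat, Complex.im_ofNat] at hz
    nlinarith
  · simp only [Complex.real_smul]
    push_cast
    ring

theorem div_reflection_im {a γ z : ℂ} (hγ : γ.im = 0) (hz : z.im = 0) :
    ((z - a) / (z - (2 * γ - a))).im =
      (γ.re - z.re) * (2 * a.im / Complex.normSq (z - (2 * γ - a))) := by
  simp only [Complex.div_im, Complex.sub_im, Complex.sub_re, Complex.mul_re, Complex.mul_im, hγ, hz,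
    Complex.re_ofNat, Complex.im_ofNat]
  ring

namespace HalfPlaneChart

variable {M : Type*} [TopologicalSpace M] (e : HalfPlaneChart M)

/-- An injective map `ψ` from `C` to the unit circle is, up to exponentials, a power of the
restriction of a map defined off a given interior point of a chart meeting `C`. -/
theorem exists_pole [T2Space M] [NormalSpace M] {C : Set M} {c p : M} (hc : c ∈ e.source)
    (hC : ∀ x ∈ e.source, x ∈ C ↔ (e.toPartialEquiv x).im = 0) (hcC : c ∈ C) (hp : p ∈ e.source)
    (hpi : 0 < (e.toPartialEquiv p).im) {ψ : M → ℂ} (hψ : ContinuousOn ψ C) (hinj : InjOn ψ C)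
    (hnorm : ∀ x ∈ C, ‖ψ x‖ = 1) :
    ∃ f : M → ℂ, ContinuousOn f {p}ᶜ ∧ (∀ x, f x ≠ 0) ∧
      ∃ (k : ℤ) (g : M → ℂ), ContinuousOn g C ∧ ∀ x ∈ C, ψ x = f x ^ k * Complex.exp (g x) := by
  classical
  set γ := e.toPartialEquiv c with hγdef
  set a := e.toPartialEquiv p with hadef
  set b := 2 * γ - a with hb
  have hγ : γ.im = 0 := (hC c hc).1 hcC
  have hbi : b.im < 0 := by simp [hb, hγ, hpi]
  have hsT : segment ℝ γ a ⊆ e.target := e.convex.segment_subset (e.map_source hc) (e.map_source hp)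
  set K := e.symm '' segment ℝ γ a with hKdef
  have hKD : K ⊆ e.source := e.symm_image_subset hsT
  have hKmem : ∀ {x}, x ∈ e.source → (x ∈ K ↔ e.toPartialEquiv x ∈ segment ℝ γ a) :=
    fun hx => e.mem_symm_image_iff hsT hx
  have hKc : IsClosed K := (e.isCompact_symm_image (isCompact_segment γ a) hsT).isClosed
  have hpK : p ∈ K := (hKmem hp).2 (right_mem_segment ℝ γ a)
  have hcK : c ∈ K := (hKmem hc).2 (left_mem_segment ℝ γ a)
  have hcp : c ≠ p := fun h => by rw [hadef, ← h, ← hγdef] at hpi; exact hpi.ne' hγ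
  have hCK : ∀ x ∈ C, x ∈ K → x = c := fun x hx hxK => by
    have hxD := hKD hxK
    have him := (hC x hxD).1 hx
    obtain ⟨α, β, hα, hβ, hαβ, h⟩ := (hKmem hxD).1 hxK
    rw [← h] at him
    simp only [Complex.add_im, Complex.smul_im, hγ, smul_eq_mul, mul_zero, zero_add,
      mul_eq_zero, hpi.ne', or_false] at him
    refine e.injOn hxD hc ?_
    rw [← h, him, (by linarith : α = 1)]
    simp [hγdef]
  have hzb : ∀ x ∈ e.source, e.toPartialEquiv x - b ≠ 0 := fun x hx h => by
    have := e.im_nonneg hx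
    rw [sub_eq_zero.1 h] at this
    linarith
  have hza : ∀ x ∈ e.source \ {p}, e.toPartialEquiv x - a ≠ 0 := fun x hx h =>
    hx.2 (e.injOn hx.1 hp (sub_eq_zero.1 h))
  set u : M → ℂ := fun x => (e.toPartialEquiv x - a) / (e.toPartialEquiv x - b) with hu
  have huc : ContinuousOn u e.source :=
    (e.continuousOn.sub continuousOn_const).div (e.continuousOn.sub continuousOn_const) hzb
  have hslit : ∀ x ∈ e.source \ K, u x ∈ Complex.slitPlane := fun x hx =>
    div_mem_slitPlane_of_notMem_segment <| notMem_segment_reflection hγ hpi (e.im_nonneg hx.1)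
      fun h => hx.2 ((hKmem hx.1).2 h)
  obtain ⟨f, l, h1, h2, -, h4, h5, h6, V, hVo, hKV, hlV⟩ := exists_glue (f := fun _ => 1)
    e.isOpen_source hKc hKD hpK (u := u) (F := fun x => Complex.log (u x))
    continuousOn_const (fun _ _ => one_ne_zero) (huc.mono sdiff_subset)
    (fun x hx => div_ne_zero (hza x hx) (hzb x hx.1)) ((huc.mono sdiff_subset).clog hslit)
    (fun x hx => by rw [one_mul, Complex.exp_log (Complex.slitPlane_ne_zero (hslit x hx))])
  have hψ0 : ∀ x ∈ C, ψ x ≠ 0 := fun x hx h => by simpa [h] using hnorm x hx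
  have hψc := hψ0 c hcC
  have hW : ∀ᶠ x in 𝓝 c, x ∈ C → ψ x / ψ c ∈ Complex.slitPlane := by
    rw [← eventually_nhdsWithin_iff]
    refine ((hψ c hcC).div_const (ψ c)).eventually (Complex.isOpen_slitPlane.mem_nhds ?_)
    simp [div_self hψc]
  obtain ⟨r, hr, hrb⟩ := Metric.mem_nhdsWithin_iff.1
    (e.preimage_mem_nhdsWithin hc (inter_mem (hVo.mem_nhds (hKV hcK)) hW))
  set l₁ : M → ℂ := fun x => Complex.log (-(ψ x / ψ c)) + Complex.log (-ψ c) with hl₁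
  set m₁ : M → ℂ := fun x => Complex.log (ψ x / ψ c) + Complex.log (ψ c) with hm₁
  have hneg : ∀ x ∈ C \ {c}, -(ψ x / ψ c) ∈ Complex.slitPlane := fun x hx => by
    rw [Complex.mem_slitPlane_iff_not_le_zero]
    intro h
    rw [Complex.nonpos_iff] at h
    refine hx.2 (hinj hx.1 hcC ?_)
    have hn : ‖ψ x / ψ c‖ = 1 := by rw [norm_div, hnorm x hx.1, hnorm c hcC, div_one]
    have h3 : (ψ x / ψ c).im = 0 := by simpa using h.2
    have h4 : 0 ≤ (ψ x / ψ c).re := by simpa using h.1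
    have h5 : ψ x / ψ c = ((ψ x / ψ c).re : ℂ) := Complex.ext (by simp) (by simp [h3])
    rw [h5, Complex.norm_real, Real.norm_of_nonneg h4] at hn
    rw [hn, Complex.ofReal_one, div_eq_one_iff_eq hψc] at h5
    exact h5
  have hl₁c : ContinuousOn l₁ (C \ {c}) :=
    (((hψ.mono sdiff_subset).div_const _).neg.clog hneg).add continuousOn_const
  have hl₁e : ∀ x ∈ C, Complex.exp (l₁ x) = ψ x := fun x hx => by
    simp only [hl₁]
    rw [Complex.exp_add, Complex.exp_log (neg_ne_zero.2 (div_ne_zero (hψ0 x hx) hψc)),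
      Complex.exp_log (neg_ne_zero.2 hψc)]
    field_simp
  have hm₁e : ∀ x ∈ C, Complex.exp (m₁ x) = ψ x := fun x hx => by
    simp only [hm₁]
    rw [Complex.exp_add, Complex.exp_log (div_ne_zero (hψ0 x hx) hψc), Complex.exp_log hψc]
    field_simp
  have hB : ∀ z ∈ ball γ r, z.im = 0 → z ∈ e.target ∧ e.symm z ∈ V ∧ e.symm z ∈ C ∧
      ψ (e.symm z) / ψ c ∈ Complex.slitPlane := fun z hz hzi => by
    have h := hrb ⟨hz, hzi.ge⟩
    have h' : e.symm z ∈ C := (hC _ (e.map_target h.1)).2 (by rw [e.right_inv h.1, hzi])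
    exact ⟨h.1, h.2.1, h', h.2.2 h'⟩
  have key : ∀ S : Set ℂ, Convex ℝ S → γ ∉ S → ∃ n : ℤ, ∀ z ∈ ball γ r, z.im = 0 → z ∈ S →
      l₁ (e.symm z) = m₁ (e.symm z) + n * (2 * Real.pi * Complex.I) := by
    intro S hS hγS
    have hconv : Convex ℝ (ball γ r ∩ {z : ℂ | z.im = 0} ∩ S) :=
      ((convex_ball γ r).inter (convex_hyperplane Complex.imLm.isLinear 0)).inter hS
    have hsub : ContinuousOn e.symm (ball γ r ∩ {z : ℂ | z.im = 0} ∩ S) :=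
      e.continuousOn_symm.mono fun z hz => (hB z hz.1.1 hz.1.2).1
    have hmem : MapsTo e.symm (ball γ r ∩ {z : ℂ | z.im = 0} ∩ S) (C \ {c}) := fun z hz => by
      have h := hB z hz.1.1 hz.1.2
      refine ⟨h.2.2.1, fun h' => hγS ?_⟩
      rw [hγdef, ← mem_singleton_iff.1 h', e.right_inv h.1]
      exact hz.2
    obtain ⟨n, hn⟩ := hconv.isPreconnected.exp_eq_exp (f := fun z => l₁ (e.symm z))
      (g := fun z => m₁ (e.symm z)) (hl₁c.comp hsub hmem)
      ((((hψ.comp hsub fun z hz => (hmem hz).1).div_const _).clog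
        fun z hz => (hB z hz.1.1 hz.1.2).2.2.2).add continuousOn_const)
      (fun z hz => by rw [hl₁e _ (hmem hz).1, hm₁e _ (hmem hz).1])
    exact ⟨n, fun z hz hzi hzS => hn z ⟨⟨hz, hzi⟩, hzS⟩⟩
  obtain ⟨n₁, hn₁⟩ := key {z | z.re < γ.re} (convex_halfSpace_lt Complex.reLm.isLinear _) (by simp)
  obtain ⟨n₂, hn₂⟩ := key {z | γ.re < z.re} (convex_halfSpace_gt Complex.reLm.isLinear _) (by simp)
  set k : ℤ := n₁ - n₂ with hk
  set g' : M → ℂ := fun x => m₁ x - k * Complex.log (-u x) + (n₁ + n₂) * (Real.pi * Complex.I)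
    with hg'
  set g : M → ℂ := fun x => if x = c then g' c else l₁ x - k * l x with hg
  have hucc : u c = -1 := by
    have h := hzb c hc
    simp only [hu, ← hγdef, hb] at h ⊢
    rw [div_eq_iff h]
    ring
  have hN : ∀ᶠ x in 𝓝 c, x ∈ C → g x = g' x := by
    filter_upwards [e.isOpen_source.mem_nhds hc,
      (e.continuousOn.continuousAt (e.isOpen_source.mem_nhds hc)).preimage_mem_nhds
        (ball_mem_nhds γ hr)] with x hxD hxb hxC
    by_cases hxc : x = c
    · simp [hg, hxc]
    have hzi := (hC x hxD).1 hxC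
    have hxK : x ∉ K := fun h => hxc (hCK x hxC h)
    have hB' := hB _ hxb hzi
    have e1 : e.symm (e.toPartialEquiv x) = x := e.left_inv hxD
    rw [e1] at hB'
    have hlx : l x = Complex.log (u x) := hlV x ⟨hB'.2.1, hxK⟩
    have him : (u x).im = _ := div_reflection_im (a := a) hγ hzi
    have hpos : 0 < 2 * a.im / Complex.normSq (e.toPartialEquiv x - (2 * γ - a)) :=
      div_pos (by linarith) (Complex.normSq_pos.2 (hzb x hxD))
    rcases lt_trichotomy (e.toPartialEquiv x).re γ.re with h | h | h
    · have h7 := hn₁ _ hxb hzi h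
      rw [e1] at h7
      have h8 : 0 < (u x).im := him ▸ mul_pos (sub_pos.2 h) hpos
      simp only [hg, hxc, if_false, hg', h7, hlx, Complex.log_eq_log_neg_add_of_im_pos h8, hk]
      push_cast
      ring
    · exact absurd (e.injOn hxD hc (Complex.ext h (hzi.trans hγ.symm))) hxc
    · have h7 := hn₂ _ hxb hzi h
      rw [e1] at h7
      have h8 : (u x).im < 0 := him ▸ mul_neg_of_neg_of_pos (sub_neg.2 h) hpos
      simp only [hg, hxc, if_false, hg', h7, hlx, Complex.log_eq_log_neg_sub_of_im_neg h8, hk]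
      push_cast
      ring
  refine ⟨f, h1, h2, k, g, fun x hx => ?_, fun x hx => ?_⟩
  · by_cases hxc : x = c
    · subst hxc
      have hg'c : ContinuousWithinAt g' C x := by
        refine ContinuousWithinAt.add (ContinuousWithinAt.sub (ContinuousWithinAt.add
          (ContinuousWithinAt.clog ((hψ x hx).div_const _) ?_) continuousWithinAt_const)
          (continuousWithinAt_const.mul (ContinuousWithinAt.clog (ContinuousAt.continuousWithinAt
            (huc.continuousAt (e.isOpen_source.mem_nhds hc))).neg ?_))) continuousWithinAt_const
        · simp [div_self hψc]
        · simp [hucc]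
      exact hg'c.congr_of_eventuallyEq (eventually_nhdsWithin_iff.2 hN) (by simp [hg])
    · have hn : C \ {c} ∈ 𝓝[C] x :=
        inter_mem self_mem_nhdsWithin (mem_nhdsWithin_of_mem_nhds
          (isOpen_compl_singleton.mem_nhds hxc))
      have hxK : x ∉ K := fun h => hxc (hCK x hx h)
      have h7 : ContinuousWithinAt (fun x => l₁ x - k * l x) C x :=
        ((hl₁c x ⟨hx, hxc⟩).mono_of_mem_nhdsWithin hn).sub (continuousWithinAt_const.mul
          (h4.continuousAt (hKc.isOpen_compl.mem_nhds hxK)).continuousWithinAt)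
      refine h7.congr_of_eventuallyEq ?_ (by simp [hg, hxc])
      filter_upwards [hn] with y hy
      have : y ≠ c := hy.2
      simp [hg, this]
  · by_cases hxc : x = c
    · subst hxc
      have h7 : Complex.exp ((n₁ + n₂) * (Real.pi * Complex.I)) = (-1) ^ (n₁ + n₂) := by
        rw [← Complex.exp_pi_mul_I, ← Complex.exp_int_mul]
        push_cast
        rfl
      simp only [hg, if_true, hg', h6 x hcK hcp, hucc, neg_neg, Complex.log_one, mul_zero, sub_zero,
        Complex.exp_add, hm₁e x hx, h7, hk]
      rw [mul_left_comm, ← zpow_add₀ (by norm_num), show n₁ - n₂ + (n₁ + n₂) = 2 * n₁ by ring,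
        zpow_mul]
      simp
    · have hxK : x ∉ K := fun h => hxc (hCK x hx h)
      simp only [hg, hxc, if_false, h5 x hxK, one_mul]
      rw [← Complex.exp_int_mul, ← Complex.exp_add, ← hl₁e x hx]
      congr 1
      ring

end HalfPlaneChart

theorem SimpleGraph.Connected.exists_ray {α : Type*} [Infinite α] {G : SimpleGraph α}
    (hG : G.Connected) (hfin : ∀ a, (G.neighborSet a).Finite) (v : α) :
    ∃ a : ℕ → α, a 0 = v ∧ Function.Injective a ∧ ∀ n, G.Adj (a n) (a (n + 1)) := by
  let S : α → Set α := fun a => {b | G.dist v b = G.dist v a + G.dist a b}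
  have step : ∀ a, (S a).Infinite → ∃ a', G.Adj a a' ∧ G.dist v a' = G.dist v a + 1 ∧
      (S a').Infinite := by
    intro a ha
    by_contra! hcon
    refine ha (((hfin a).biUnion (t := fun a' => {b | b ∈ S a' ∧ G.dist v a' = G.dist v a + 1})
      fun a' ha' => ?_).union (finite_singleton a) |>.subset fun b hb => ?_)
    · by_cases hd : G.dist v a' = G.dist v a + 1
      · exact (hcon a' ha' hd).subset fun b hb => hb.1
      · simp [hd]
    · rcases eq_or_ne b a with rfl | hba
      · exact Or.inr rfl
      obtain ⟨w, hw⟩ := hG.exists_walk_length_eq_dist a b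
      cases w with
      | nil => exact absurd rfl hba
      | @cons _ a' _ h p =>
        have hb' : G.dist v b = G.dist v a + G.dist a b := hb
        rw [SimpleGraph.Walk.length_cons] at hw
        have h1 := SimpleGraph.dist_le p
        have h2 := hG.dist_triangle (u := v) (v := a') (w := b)
        have h3 := hG.dist_triangle (u := v) (v := a) (w := a')
        rw [SimpleGraph.dist_eq_one_iff_adj.2 h] at h3
        refine Or.inl (mem_biUnion (SimpleGraph.mem_neighborSet _ _ _ |>.2 h) ⟨?_, ?_⟩)
        · change G.dist v b = G.dist v a' + G.dist a' b
          omega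
        · omega
  have hv : (S v).Infinite := by
    have : S v = univ := by ext b; simp [S]
    rw [this]
    exact infinite_univ
  choose! φ hφ using step
  let a : ℕ → α := fun n => φ^[n] v
  have ha : ∀ n, a (n + 1) = φ (a n) := fun n => Function.iterate_succ_apply' φ n v
  have hinf : ∀ n, (S (a n)).Infinite := by
    intro n
    induction n with
    | zero => exact hv
    | succ n ih => rw [ha]; exact (hφ _ ih).2.2
  have hd : ∀ n, G.dist v (a n) = n := by
    intro n
    induction n with
    | zero => simp [a]
    | succ n ih => rw [ha, (hφ _ (hinf n)).2.1, ih]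
  refine ⟨a, rfl, fun m n h => ?_, fun n => ?_⟩
  · rw [← hd m, h, hd n]
  · rw [ha]
    exact (hφ _ (hinf n)).1

theorem exists_seq_inter_nonempty {M α : Type*} [TopologicalSpace M] [ConnectedSpace M]
    (hnc : ¬ CompactSpace M) {D : α → Set M} (ho : ∀ a, IsOpen (D a)) (hne : ∀ a, (D a).Nonempty)
    (hlf : LocallyFinite D) (hK : ∀ a, ∃ K, IsCompact K ∧ D a ⊆ K) (hcov : ⋃ a, D a = univ)
    (a₀ : α) : ∃ a : ℕ → α, a 0 = a₀ ∧ Function.Injective a ∧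
      ∀ n, (D (a n) ∩ D (a (n + 1))).Nonempty := by
  let G : SimpleGraph α := SimpleGraph.fromRel fun a b => (D a ∩ D b).Nonempty
  have hadj : ∀ {a b}, G.Adj a b ↔ a ≠ b ∧ (D a ∩ D b).Nonempty := by
    intro a b
    rw [SimpleGraph.fromRel_adj, inter_comm (D b), or_self]
  choose K hKc hDK using hK
  have hfin : ∀ a, (G.neighborSet a).Finite := fun a =>
    (hlf.finite_nonempty_inter_compact (hKc a)).subset fun b hb =>
      (hadj.1 hb).2.mono fun x hx => ⟨hx.2, hDK a hx.1⟩
  have hinf : Infinite α := by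
    by_contra h
    rw [not_infinite_iff_finite] at h
    refine hnc ⟨(isCompact_iUnion hKc).of_isClosed_subset isClosed_univ ?_⟩
    rw [← hcov]
    exact iUnion_mono hDK
  have hconn : G.Connected := by
    have : Nonempty α := ⟨a₀⟩
    refine ⟨fun a b => ?_⟩
    by_contra hab
    obtain ⟨x, -, hx1, hx2⟩ := isPreconnected_univ (α := M)
      (⋃ c ∈ {c | G.Reachable a c}, D c) (⋃ c ∈ {c | ¬ G.Reachable a c}, D c)
      (isOpen_biUnion fun c _ => ho c) (isOpen_biUnion fun c _ => ho c)
      (fun x _ => by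
        obtain ⟨c, hc⟩ := mem_iUnion.1 (hcov ▸ mem_univ x)
        by_cases h : G.Reachable a c
        · exact Or.inl (mem_biUnion h hc)
        · exact Or.inr (mem_biUnion h hc))
      ((hne a).imp fun x hx => ⟨mem_univ _, mem_biUnion (SimpleGraph.Reachable.refl a) hx⟩)
      ((hne b).imp fun x hx => ⟨mem_univ _, mem_biUnion hab hx⟩)
    simp only [mem_iUnion, mem_ofPred_eq, exists_prop] at hx1 hx2
    obtain ⟨c, hc, hxc⟩ := hx1
    obtain ⟨d, hd, hxd⟩ := hx2
    refine hd (hc.trans (SimpleGraph.Adj.reachable (hadj.2 ⟨?_, x, hxc, hxd⟩)))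
    rintro rfl
    exact hd hc
  obtain ⟨a, h0, hi, h⟩ := hconn.exists_ray hfin a₀
  exact ⟨a, h0, hi, fun n => (hadj.1 (h n)).2⟩

/-- The identification of the Euclidean half-plane with the closed upper half-plane in `ℂ`. -/
def EuclideanHalfSpace.toComplex (y : EuclideanHalfSpace 2) : ℂ := ⟨y.1 1, y.1 0⟩

/-- A continuous left inverse of `EuclideanHalfSpace.toComplex`. -/
def EuclideanHalfSpace.ofComplex (z : ℂ) : EuclideanHalfSpace 2 :=
  ⟨!₂[max z.im 0, z.re], by simp⟩

namespace EuclideanHalfSpace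

theorem continuous_toComplex : Continuous toComplex := by
  have h : toComplex = fun y => Complex.equivRealProdCLM.symm (y.1 1, y.1 0) := by
    ext y
    apply Complex.ext <;> simp [toComplex]
  rw [h]
  have h0 : ∀ i : Fin 2, Continuous fun y : EuclideanHalfSpace 2 => y.1 i := fun i =>
    (PiLp.continuous_apply 2 _ i).comp continuous_subtype_val
  exact Complex.equivRealProdCLM.symm.continuous.comp ((h0 1).prodMk (h0 0))

theorem continuous_ofComplex : Continuous ofComplex := by
  refine Continuous.subtype_mk ((PiLp.continuous_toLp 2 _).comp (continuous_pi fun i => ?_)) _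
  fin_cases i
  · exact Complex.continuous_im.max continuous_const
  · exact Complex.continuous_re

theorem ofComplex_toComplex (y : EuclideanHalfSpace 2) : ofComplex (toComplex y) = y := by
  ext i
  fin_cases i
  · simpa [ofComplex, toComplex] using y.2
  · simp [ofComplex, toComplex]

theorem toComplex_ofComplex {z : ℂ} (hz : 0 ≤ z.im) : toComplex (ofComplex z) = z := by
  apply Complex.ext <;> simp [toComplex, ofComplex, hz]

end EuclideanHalfSpace

namespace HalfPlaneChart

open EuclideanHalfSpace

variable {M : Type*} [TopologicalSpace M]

/-- The restriction of a half-space chart to the preimage of a half-disc. -/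
def ofOpenPartialHomeomorph (φ : OpenPartialHomeomorph M (EuclideanHalfSpace 2)) (c : ℂ) (r : ℝ)
    (h : ∀ z ∈ ball c r, ofComplex z ∈ φ.target) : HalfPlaneChart M where
  toFun x := toComplex (φ x)
  invFun z := φ.symm (ofComplex z)
  source := φ.source ∩ φ ⁻¹' (toComplex ⁻¹' ball c r)
  target := ball c r ∩ {z | 0 ≤ z.im}
  map_source' x hx := ⟨hx.2, (φ x).2⟩
  map_target' z hz := by
    refine ⟨φ.map_target (h z hz.1), ?_⟩
    rw [mem_preimage, φ.right_inv (h z hz.1), mem_preimage, toComplex_ofComplex hz.2]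
    exact hz.1
  left_inv' x hx := by rw [ofComplex_toComplex, φ.left_inv hx.1]
  right_inv' z hz := by rw [φ.right_inv (h z hz.1), toComplex_ofComplex hz.2]
  isOpen_source := φ.isOpen_inter_preimage (isOpen_ball.preimage continuous_toComplex)
  continuousOn := continuous_toComplex.comp_continuousOn (φ.continuousOn.mono inter_subset_left)
  continuousOn_symm := φ.continuousOn_symm.comp continuous_ofComplex.continuousOn
    fun z hz => h z hz.1
  exists_isOpen := ⟨_, isOpen_ball, rfl⟩
  convex := (convex_ball c r).inter (convex_halfSpace_ge Complex.imLm.isLinear 0)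

/-- Interior points are dense in a chart. -/
theorem exists_im_pos (e : HalfPlaneChart M) {x : M} (hx : x ∈ e.source) {V : Set M}
    (hV : V ∈ 𝓝 x) : ∃ y ∈ e.source ∩ V, 0 < (e.toPartialEquiv y).im := by
  obtain ⟨r, hr, h⟩ := Metric.mem_nhdsWithin_iff.1 (e.preimage_mem_nhdsWithin hx hV)
  have hi := e.im_nonneg hx
  set z : ℂ := e.toPartialEquiv x + (r / 2 : ℝ) * Complex.I with hz
  have hzi : 0 < z.im := by simp [hz]; positivity
  obtain ⟨hzt, hzV⟩ := h (a := z) ⟨by simp [hz, dist_eq_norm, abs_of_pos hr, hr], hzi.le⟩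
  refine ⟨e.symm z, ⟨e.map_target hzt, hzV⟩, ?_⟩
  rwa [e.right_inv hzt]

variable [ChartedSpace (EuclideanHalfSpace 2) M]

theorem exists_source_subset {x : M} {V : Set M} (hV : V ∈ 𝓝 x) :
    ∃ e : HalfPlaneChart M, x ∈ e.source ∧ e.source ⊆ V ∧
      (x ∈ surfaceBoundary M ↔ (e.toPartialEquiv x).im = 0) := by
  set φ := chartAt (EuclideanHalfSpace 2) x with hφ
  have hx : x ∈ φ.source := mem_chart_source _ x
  have h1 : φ.target ∩ φ.symm ⁻¹' V ∈ 𝓝 (φ x) := by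
    refine inter_mem (φ.open_target.mem_nhds (φ.map_source hx)) ?_
    apply (φ.continuousAt_symm (φ.map_source hx)).preimage_mem_nhds
    rwa [φ.left_inv hx]
  have h2 : ofComplex ⁻¹' (φ.target ∩ φ.symm ⁻¹' V) ∈ 𝓝 (toComplex (φ x)) := by
    apply continuous_ofComplex.continuousAt.preimage_mem_nhds
    rwa [ofComplex_toComplex]
  obtain ⟨r, hr, hrs⟩ := Metric.mem_nhds_iff.1 h2
  refine ⟨ofOpenPartialHomeomorph φ (toComplex (φ x)) r fun z hz => (hrs hz).1,
    ⟨hx, mem_ball_self hr⟩, fun y hy => ?_, ?_⟩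
  · have := (hrs hy.2).2
    rwa [ofComplex_toComplex, mem_preimage, φ.left_inv hy.1] at this
  · change (extChartAt (modelWithCornersEuclideanHalfSpace 2) x) x ∈ frontier _ ↔ (φ x).1 0 = 0
    rw [frontier_range_modelWithCornersEuclideanHalfSpace, mem_ofPred_eq, eq_comm]
    rfl

theorem mem_surfaceBoundary_iff (e : HalfPlaneChart M) {x : M} (hx : x ∈ e.source) :
    x ∈ surfaceBoundary M ↔ (e.toPartialEquiv x).im = 0 := by
  obtain ⟨e', hx', -, h⟩ := exists_source_subset (univ_mem : univ ∈ 𝓝 x)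
  rw [h]
  constructor <;> intro h0 <;> by_contra hne
  · exact (e.im_pos_of_im_pos e' hx hx' ((e.im_nonneg hx).lt_of_ne' hne)).ne' h0
  · exact (e'.im_pos_of_im_pos e hx' hx ((e'.im_nonneg hx').lt_of_ne' hne)).ne' h0

/-- A component of the boundary meeting a chart contains the whole boundary line of that chart. -/
theorem mem_connectedComponentIn_iff (e : HalfPlaneChart M) {c x : M} (hc : c ∈ e.source)
    (hcb : c ∈ surfaceBoundary M) (hx : x ∈ e.source) :
    x ∈ connectedComponentIn (surfaceBoundary M) c ↔ (e.toPartialEquiv x).im = 0 := by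
  refine ⟨fun h => (e.mem_surfaceBoundary_iff hx).1 (connectedComponentIn_subset _ _ h),
    fun h => ?_⟩
  have hpre : IsPreconnected (e.symm '' (e.target ∩ {z | z.im = 0})) :=
    (e.convex.inter (convex_hyperplane Complex.imLm.isLinear 0)).isPreconnected.image _
      (e.continuousOn_symm.mono inter_subset_left)
  have hmem : ∀ y ∈ e.source, (e.toPartialEquiv y).im = 0 →
      y ∈ e.symm '' (e.target ∩ {z | z.im = 0}) := fun y hy h =>
    ⟨_, ⟨e.map_source hy, h⟩, e.left_inv hy⟩
  refine hpre.subset_connectedComponentIn (hmem c hc ((e.mem_surfaceBoundary_iff hc).1 hcb)) ?_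
    (hmem x hx h)
  rintro _ ⟨z, ⟨hz, hz0⟩, rfl⟩
  rw [e.mem_surfaceBoundary_iff (e.map_target hz), e.right_inv hz]
  exact hz0

theorem exists_locallyFinite_cover.{u} (M : Type u) [TopologicalSpace M] [T2Space M]
    [SigmaCompactSpace M] [LocallyCompactSpace M] [ChartedSpace (EuclideanHalfSpace 2) M] :
    ∃ (α : Type u) (e : α → HalfPlaneChart M), (∀ a, (e a).source.Nonempty) ∧
      (LocallyFinite fun a => (e a).source) ∧ (∀ a, ∃ K, IsCompact K ∧ (e a).source ⊆ K) ∧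
      ⋃ a, (e a).source = univ := by
  have hB : ∀ x : M, (𝓝 x).HasBasis
      (fun e : HalfPlaneChart M => x ∈ e.source ∧ ∃ K, IsCompact K ∧ e.source ⊆ K)
      (fun e => e.source) := by
    refine fun x => ⟨fun V => ⟨fun hV => ?_, fun ⟨e, he, h⟩ =>
      mem_of_superset (e.isOpen_source.mem_nhds he.1) h⟩⟩
    obtain ⟨K, hK, hxK⟩ := exists_compact_mem_nhds x
    obtain ⟨e, hxe, he, -⟩ := exists_source_subset (inter_mem hV hxK)
    exact ⟨e, ⟨hxe, K, hK, he.trans inter_subset_right⟩, he.trans inter_subset_left⟩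
  obtain ⟨α, c, e, hp, hcov, hlf⟩ := refinement_of_locallyCompact_sigmaCompact_of_nhds_basis hB
  exact ⟨α, e, fun a => ⟨c a, (hp a).1⟩, hlf, fun a => (hp a).2, hcov⟩

end HalfPlaneChart

/-- Push the pole of a nonvanishing function to infinity along a locally finite chain of charts. -/
theorem exists_continuous_of_chain {M : Type*} [TopologicalSpace M] [T2Space M] [NormalSpace M]
    {C : Set M} (hC : IsCompact C) {e : ℕ → HalfPlaneChart M}
    (hlf : LocallyFinite fun n => (e n).source) {p : ℕ → M} (hp : ∀ n, p n ∈ (e n).source)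
    (hp' : ∀ n, p n ∈ (e (n + 1)).source)
    (hpi : ∀ n, 0 < ((e n).toPartialEquiv (p n)).im)
    (hCi : ∀ n, ∀ x ∈ (e n).source, x ∈ C → ((e n).toPartialEquiv x).im = 0)
    {f₀ : M → ℂ} (hf₀ : ContinuousOn f₀ {p 0}ᶜ) (h0 : ∀ x, f₀ x ≠ 0) :
    ∃ F : M → ℂ, Continuous F ∧ (∀ x, F x ≠ 0) ∧
      ∃ l, ContinuousOn l C ∧ ∀ x ∈ C, F x = f₀ x * Complex.exp (l x) := by
  let P : ℕ → (M → ℂ) → Prop := fun n f => ContinuousOn f {p n}ᶜ ∧ (∀ x, f x ≠ 0) ∧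
    ∃ l, ContinuousOn l C ∧ ∀ x ∈ C, f x = f₀ x * Complex.exp (l x)
  have step : ∀ n f, P n f → ∃ f', P (n + 1) f' ∧ ∀ x ∉ (e (n + 1)).source, f' x = f x := by
    rintro n f ⟨hf, hne, l, hl, hfl⟩
    obtain ⟨f', hf', hne', heq, l', hl', hfl'⟩ := (e (n + 1)).exists_move_pole (hp' n)
      (hp (n + 1)) ((e n).im_pos_of_im_pos _ (hp n) (hp' n) (hpi n)) (hpi (n + 1)) hf hne
    have hCS : C ⊆ ((e (n + 1)).source ∩ {x | 0 < ((e (n + 1)).toPartialEquiv x).im})ᶜ :=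
      fun x hx h => h.2.ne' (hCi _ x h.1 hx)
    refine ⟨f', ⟨hf', hne', fun x => l x + l' x, hl.add (hl'.mono hCS), fun x hx => ?_⟩, heq⟩
    rw [hfl' x (hCS hx), hfl x hx, Complex.exp_add, mul_assoc]
  choose! Φ hΦ using step
  let f : ℕ → M → ℂ := fun n => Nat.rec f₀ Φ n
  have hP : ∀ n, P n (f n) := by
    intro n
    induction n with
    | zero => exact ⟨hf₀, h0, 0, continuousOn_const, fun x _ => by simp [f]⟩
    | succ n ih => exact (hΦ n _ ih).1
  have hlf' : LocallyFinite fun n => {x | f (n + 1) x ≠ f n x} := by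
    refine (hlf.comp_injective (add_left_injective 1)).subset fun n x hx => ?_
    by_contra h
    exact hx ((hΦ n _ (hP n)).2 x h)
  obtain ⟨F, hF⟩ := hlf'.exists_forall_eventually_eq_prod
  have hF' : ∀ x, ∀ᶠ n in atTop, f n =ᶠ[𝓝 x] F := fun x => (hF x).curry
  refine ⟨F, continuous_iff_continuousAt.2 fun x => ?_, fun x => ?_, ?_⟩
  · have hx : ∀ᶠ n in atTop, x ∉ (e n).source := by
      rw [← Nat.cofinite_eq_atTop]
      exact (hlf.point_finite x).compl_mem_cofinite
    obtain ⟨n, hn, hn'⟩ := (hx.and (hF' x)).exists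
    have hxp : x ∈ ({p n}ᶜ : Set M) := fun h => hn (h ▸ hp n)
    exact ((hP n).1.continuousAt (isOpen_compl_singleton.mem_nhds hxp)).congr hn'
  · obtain ⟨n, hn⟩ := (hF' x).exists
    exact hn.eq_of_nhds ▸ (hP n).2.1 x
  · have hFC : ∀ᶠ q : ℕ × M in atTop ×ˢ 𝓝ˢ C, f q.1 q.2 = F q.2 :=
      hC.mem_prod_nhdsSet_of_forall fun x _ => hF x
    obtain ⟨n, hn⟩ := hFC.curry.exists
    obtain ⟨l, hl, hfl⟩ := (hP n).2.2
    exact ⟨l, hl, fun x hx => (hn.self_of_nhdsSet x hx).symm.trans (hfl x hx)⟩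

/-- A function on a closed set which is, up to an exponential, a power of a nonvanishing function
on the whole space extends to a nonvanishing function. -/
theorem exists_extension_of_eq_zpow_mul_exp {M : Type*} [TopologicalSpace M] [NormalSpace M]
    {C : Set M} (hC : IsClosed C) {F g ψ : M → ℂ}
    (hF : Continuous F) (h0 : ∀ x, F x ≠ 0) (k : ℤ) (hg : ContinuousOn g C)
    (hψ : ∀ x ∈ C, ψ x = F x ^ k * Complex.exp (g x)) :
    ∃ G : M → ℂ, Continuous G ∧ (∀ x, G x ≠ 0) ∧ EqOn G ψ C := by
  obtain ⟨γ, hγ⟩ := ContinuousMap.exists_restrict_eq hC ⟨C.domRestrict g, hg.domRestrict⟩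
  refine ⟨fun x => F x ^ k * Complex.exp (γ x),
    (hF.zpow₀ k fun x => Or.inl (h0 x)).mul (Complex.continuous_exp.comp γ.continuous),
    fun x => mul_ne_zero (zpow_ne_zero k (h0 x)) (Complex.exp_ne_zero _), fun x hx => ?_⟩
  have : γ x = g x := DFunLike.congr_fun hγ ⟨x, hx⟩
  simp only [this, hψ x hx]

theorem exists_extension_of_homeomorph_circle {M : Type*} [TopologicalSpace M] [T2Space M]
    [SigmaCompactSpace M] [ChartedSpace (EuclideanHalfSpace 2) M] [ConnectedSpace M]
    (hnc : ¬ CompactSpace M) {c : M} (hc : c ∈ surfaceBoundary M)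
    (hcomp : IsCompact (connectedComponentIn (surfaceBoundary M) c)) {ψ : M → ℂ}
    (hψ : ContinuousOn ψ (connectedComponentIn (surfaceBoundary M) c))
    (hinj : InjOn ψ (connectedComponentIn (surfaceBoundary M) c))
    (hnorm : ∀ x ∈ connectedComponentIn (surfaceBoundary M) c, ‖ψ x‖ = 1) :
    ∃ G : M → ℂ, Continuous G ∧ (∀ x, G x ≠ 0) ∧
      EqOn G ψ (connectedComponentIn (surfaceBoundary M) c) := by
  set C := connectedComponentIn (surfaceBoundary M) c
  have : LocallyCompactSpace (EuclideanHalfSpace 2) :=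
    (modelWithCornersEuclideanHalfSpace 2).locallyCompactSpace
  have : LocallyCompactSpace M := ChartedSpace.locallyCompactSpace (EuclideanHalfSpace 2) M
  obtain ⟨α, e, hne, hlf, hK, hcov⟩ := HalfPlaneChart.exists_locallyFinite_cover M
  obtain ⟨a₀, ha₀⟩ := mem_iUnion.1 (hcov ▸ mem_univ c)
  obtain ⟨a, rfl, hainj, hmeet⟩ :=
    exists_seq_inter_nonempty hnc (fun a => (e a).isOpen_source) hne hlf hK hcov a₀
  have hpole : ∀ n, ∃ p, p ∈ (e (a n)).source ∧ p ∈ (e (a (n + 1))).source ∧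
      0 < ((e (a n)).toPartialEquiv p).im := by
    intro n
    obtain ⟨x, hx, hx'⟩ := hmeet n
    obtain ⟨p, hp, hpi⟩ := (e (a n)).exists_im_pos hx ((e (a (n + 1))).isOpen_source.mem_nhds hx')
    exact ⟨p, hp.1, hp.2, hpi⟩
  choose p hp hp' hpi using hpole
  obtain ⟨f₀, hf₀, h0, k, g, hg, hψg⟩ := (e (a 0)).exists_pole ha₀
    (fun x hx => (e (a 0)).mem_connectedComponentIn_iff ha₀ hc hx) (mem_connectedComponentIn hc)
    (hp 0) (hpi 0) hψ hinj hnorm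
  obtain ⟨F, hF, hF0, l, hl, hFl⟩ := exists_continuous_of_chain hcomp
    (hlf.comp_injective hainj) hp hp' hpi
    (fun n x hx hxC => ((e (a n)).mem_surfaceBoundary_iff hx).1 (connectedComponentIn_subset _ _ hxC))
    hf₀ h0
  refine exists_extension_of_eq_zpow_mul_exp hcomp.isClosed hF hF0 k
    (g := fun x => g x - k * l x) (hg.sub (continuousOn_const.mul hl)) fun x hx => ?_
  rw [hψg x hx, hFl x hx, mul_zpow, ← Complex.exp_int_mul, mul_assoc, ← Complex.exp_add]
  congr 2
  ring

end BoundaryRetract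

variable (M : Type*) [TopologicalSpace M] [T2Space M] [SigmaCompactSpace M]
  [ChartedSpace (EuclideanHalfSpace 2) M] [ConnectedSpace M]

/-- Every boundary circle `C` of a σ-compact non-compact connected 2-manifold `M`
is a retract of `M`. -/
theorem boundary_circle_retract (hnc : ¬ CompactSpace M) (C : Set M)
    (hC : ∃ x ∈ surfaceBoundary M, C = connectedComponentIn (surfaceBoundary M) x)
    (hcirc : Nonempty (↥C ≃ₜ Circle2)) :
    ∃ r : M → ↥C, Continuous r ∧ ∀ x : ↥C, r ↑x = x := by
  classical
  obtain ⟨c, hc, rfl⟩ := hC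
  set C := connectedComponentIn (surfaceBoundary M) c
  obtain ⟨φ⟩ := hcirc
  have : CompactSpace C := φ.symm.compactSpace
  let T := Complex.orthonormalBasisOneI.repr
  let ψ : M → ℂ := fun x => if h : x ∈ C then T.symm (φ ⟨x, h⟩ : EuclideanSpace ℝ (Fin 2)) else 0
  have hψC : ∀ x : C, ψ x = T.symm (φ x : EuclideanSpace ℝ (Fin 2)) := fun x => dif_pos x.2
  have hψr : (connectedComponentIn (surfaceBoundary M) c).domRestrict ψ =
      fun x => T.symm (φ x : EuclideanSpace ℝ (Fin 2)) := funext hψC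
  have hnorm : ∀ x : C, ‖ψ x‖ = 1 := fun x => by
    rw [hψC, LinearIsometryEquiv.norm_map]
    exact mem_sphere_zero_iff_norm.1 (φ x).2
  obtain ⟨G, hG, hG0, hGψ⟩ := exists_extension_of_homeomorph_circle hnc hc
    (isCompact_iff_compactSpace.2 this) (ψ := ψ)
    (continuousOn_iff_continuous_domRestrict.2 <| hψr ▸
      T.symm.continuous.comp (continuous_subtype_val.comp φ.continuous))
    (Set.injOn_iff_injective.2 <| hψr ▸
      T.symm.injective.comp (Subtype.val_injective.comp φ.injective))
    (fun x hx => hnorm ⟨x, hx⟩)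
  have hmem : ∀ x, T ((‖G x‖⁻¹ : ℝ) • G x) ∈ Metric.sphere (0 : EuclideanSpace ℝ (Fin 2)) 1 := by
    intro x
    rw [mem_sphere_zero_iff_norm, LinearIsometryEquiv.norm_map, norm_smul, norm_inv, norm_norm,
      inv_mul_cancel₀ (norm_ne_zero_iff.2 (hG0 x))]
  refine ⟨fun x => φ.symm ⟨_, hmem x⟩, φ.symm.continuous.comp (Continuous.subtype_mk
    (T.continuous.comp ((hG.norm.inv₀ fun x => norm_ne_zero_iff.2 (hG0 x)).smul hG)) _),
    fun x => ?_⟩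
  rw [Homeomorph.symm_apply_eq]
  ext1
  change T ((‖G x‖⁻¹ : ℝ) • G x) = _
  rw [hGψ x.2, hnorm x, inv_one, one_smul, hψC, LinearIsometryEquiv.apply_symm_apply]

end
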